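/- arXiv:2205.02533 — 4 statements merged into one kernel-verified Lean document; each statement's English description precedes it below -/
import Mathlib

section
/- Let M, L be positive integers and write N = ML. Let Q ∈ ℂ^{M×N} be block-structured with associated vector q ∈ ℂ^{N}, i.e., the (m₁, (m₂−1)L+l) entry of Q equals q_{(m₁−1)L+l} when m₁ = m₂ and 0 otherwise. Then for every B ∈ ℂ^{M×M} and A ∈ ℂ^{N×N}: tr(Q^H B Q A) = q^H ((B ⊗ J_L) ⊙ Aᵀ) q, where J_L is the L×L all-ones matrix, ⊗ is the Kronecker product, and ⊙ is the Hadamard (entrywise) product. -/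
open scoped Matrix Kronecker

/-- Eq. (22b) of the paper: for a block-structured `Q` (rows indexed by `Fin M`,
columns by `Fin M × Fin L`, matching the paper's column index `(m-1)L + l`) with
associated vector `q`, one has `tr(Qᴴ B Q A) = qᴴ ((B ⊗ J_L) ⊙ Aᵀ) q`, where `J_L`
is the `L × L` all-ones matrix, `⊗ₖ` the Kronecker product and `⊙` the Hadamard
product. -/
theorem stmt_3 (M L : ℕ) (hM : 0 < M) (hL : 0 < L)
    (Q : Matrix (Fin M) (Fin M × Fin L) ℂ) (q : Fin M × Fin L → ℂ)
    (hQ : ∀ (m₁ m₂ : Fin M) (l : Fin L),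
      Q m₁ (m₂, l) = if m₁ = m₂ then q (m₁, l) else 0)
    (B : Matrix (Fin M) (Fin M) ℂ)
    (A : Matrix (Fin M × Fin L) (Fin M × Fin L) ℂ)
    (J : Matrix (Fin L) (Fin L) ℂ) (hJ : ∀ i j, J i j = 1) :
    (Qᴴ * B * Q * A).trace = star q ⬝ᵥ (((B ⊗ₖ J) ⊙ Aᵀ) *ᵥ q) := by
  have hentry : ∀ p r : Fin M × Fin L,
      (Qᴴ * B * Q) p r = star (q p) * B p.1 r.1 * q r := by
    rintro ⟨i, k⟩ ⟨j, l⟩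
    simp [Matrix.mul_apply, hQ, apply_ite star]
  simp only [Matrix.trace, Matrix.diag_apply, Matrix.mul_apply (M := Qᴴ * B * Q), hentry,
    dotProduct, Matrix.mulVec, Finset.mul_sum, Pi.star_apply, Matrix.hadamard_apply,
    Matrix.kroneckerMap_apply, Matrix.transpose_apply, hJ]
  refine Finset.sum_congr rfl fun p _ => Finset.sum_congr rfl fun r _ => ?_
  ring
end

section
/- Let M, L be positive integers, N = ML, and let Q ∈ ℂ^{M×N} be block-structured with associated vector q ∈ ℂ^{N}. Let B ∈ ℂ^{M×M} be arbitrary and let D ∈ ℂ^{N×N} be diagonal. Then tr(Q^H B Q D) = q^H ((B̃ ⊗ I_L) ⊙ D) q, where B̃ ∈ ℂ^{M×M} is the diagonal matrix whose diagonal entries coincide with those of B (i.e., B̃_{m,m} = B_{m,m}), I_L is the L×L identity matrix, ⊗ is the Kronecker product, and ⊙ is the Hadamard product. -/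
open scoped Matrix Kronecker

/-- Eq. (22c) of the paper: for a block-structured `Q` with associated vector `q`,
arbitrary `B` and diagonal `D`, one has `tr(Qᴴ B Q D) = qᴴ ((B̃ ⊗ I_L) ⊙ D) q`,
where `B̃` is the diagonal matrix carrying the main diagonal of `B`, `I_L` the
`L × L` identity, `⊗ₖ` the Kronecker product and `⊙` the Hadamard product. -/
theorem stmt_4 (M L : ℕ) (hM : 0 < M) (hL : 0 < L)
    (Q : Matrix (Fin M) (Fin M × Fin L) ℂ) (q : Fin M × Fin L → ℂ)
    (hQ : ∀ (m₁ m₂ : Fin M) (l : Fin L),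
      Q m₁ (m₂, l) = if m₁ = m₂ then q (m₁, l) else 0)
    (B : Matrix (Fin M) (Fin M) ℂ)
    (D : Matrix (Fin M × Fin L) (Fin M × Fin L) ℂ) (hD : D.IsDiag) :
    (Qᴴ * B * Q * D).trace =
      star q ⬝ᵥ ((((Matrix.diagonal fun m => B m m) ⊗ₖ
        (1 : Matrix (Fin L) (Fin L) ℂ)) ⊙ D) *ᵥ q) := by
  obtain ⟨d, rfl⟩ : ∃ d, D = Matrix.diagonal d := ⟨D.diag, hD.diagonal_diag.symm⟩
  have hadamard_eq : ((Matrix.diagonal fun m => B m m) ⊗ₖ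
      (1 : Matrix (Fin L) (Fin L) ℂ)) ⊙ Matrix.diagonal d =
      Matrix.diagonal fun i => B i.1 i.1 * d i := by
    ext i j
    by_cases h : i = j
    · subst h
      simp [Matrix.hadamard_apply]
    · simp [Matrix.hadamard_apply, h]
  rw [hadamard_eq, Matrix.trace, dotProduct]
  refine Finset.sum_congr rfl fun i _ => ?_
  obtain ⟨m, l⟩ := i
  simp only [Matrix.diag_apply, Matrix.mul_diagonal, Matrix.mulVec_diagonal, Pi.star_apply]
  simp only [Matrix.mul_apply, Matrix.conjTranspose_apply, hQ]
  simp [apply_ite (starRingEnd ℂ), ite_mul]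
  ring
end

section
/- Let n be a positive integer and let E ∈ ℂ^{n×n} be Hermitian positive definite. Then for every Hermitian positive definite M ∈ ℂ^{n×n}: Re(tr(M E)) − log(det M).re ≥ n + log(det E).re, where det M and det E are positive reals (so their logarithms are real), and equality holds if and only if M = E⁻¹. Consequently, M = E⁻¹ is the unique minimizer of M ↦ tr(M E) − log det M over Hermitian positive definite matrices. -/
open scoped Matrix ComplexOrder

namespace Matrix

variable {ι : Type*} [Fintype ι] [DecidableEq ι] {A M E : Matrix ι ι ℂ}

theorem IsHermitian.eigenvalues_eq_one_iff (hA : A.IsHermitian) :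
    (∀ i, hA.eigenvalues i = 1) ↔ A = 1 := by
  constructor
  · intro h
    have hcomp : (RCLike.ofReal ∘ hA.eigenvalues : ι → ℂ) = fun _ => 1 := by
      ext i
      simp [h i]
    rw [hA.spectral_theorem, hcomp, diagonal_one, map_one]
  · rintro rfl i
    have hi : hA.eigenvalues i ∈ spectrum ℝ (1 : Matrix ι ι ℂ) :=
      hA.spectrum_real_eq_range_eigenvalues ▸ Set.mem_range_self i
    have : Nonempty ι := ⟨i⟩
    simpa [spectrum.one_eq] using hi

theorem IsHermitian.re_trace_eq_sum_eigenvalues (hA : A.IsHermitian) :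
    A.trace.re = ∑ i, hA.eigenvalues i := by
  simp [hA.trace_eq_sum_eigenvalues]

theorem PosDef.log_re_det_eq_sum_log_eigenvalues (hA : A.PosDef) :
    Real.log A.det.re = ∑ i, Real.log (hA.1.eigenvalues i) := by
  have hdet : A.det = ((∏ i, hA.1.eigenvalues i : ℝ) : ℂ) := by
    simp [hA.1.det_eq_prod_eigenvalues]
  rw [hdet, Complex.ofReal_re, Real.log_prod fun i _ => (hA.eigenvalues_pos i).ne']

theorem PosDef.log_re_det_le (hA : A.PosDef) :
    Real.log A.det.re ≤ A.trace.re - Fintype.card ι := by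
  rw [hA.log_re_det_eq_sum_log_eigenvalues, hA.1.re_trace_eq_sum_eigenvalues]
  simpa using Finset.sum_le_sum fun i (_ : i ∈ Finset.univ) =>
    Real.log_le_sub_one_of_pos (hA.eigenvalues_pos i)

theorem PosDef.log_re_det_eq_iff (hA : A.PosDef) :
    Real.log A.det.re = A.trace.re - Fintype.card ι ↔ A = 1 := by
  constructor
  · intro h
    rw [hA.log_re_det_eq_sum_log_eigenvalues, hA.1.re_trace_eq_sum_eigenvalues] at h
    have hsum : ∑ i, Real.log (hA.1.eigenvalues i) = ∑ i, (hA.1.eigenvalues i - 1) := by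
      simpa using h
    rw [Finset.sum_eq_sum_iff_of_le fun i _ =>
      Real.log_le_sub_one_of_pos (hA.eigenvalues_pos i)] at hsum
    refine hA.1.eigenvalues_eq_one_iff.1 fun i => ?_
    by_contra hi
    exact (Real.log_lt_sub_one_of_pos (hA.eigenvalues_pos i) hi).ne (hsum i (Finset.mem_univ i))
  · rintro rfl
    simp

open scoped MatrixOrder in
/-- The product of two positive definite matrices has the trace and the determinant of a positive
definite matrix congruent to the first factor. -/
theorem PosDef.exists_posDef_trace_det_mul (hM : M.PosDef) (hE : E.PosDef) :
    ∃ A : Matrix ι ι ℂ, A.PosDef ∧ A.trace = (M * E).trace ∧ A.det = M.det * E.det ∧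
      (A = 1 ↔ M = E⁻¹) := by
  have hEu := (isUnit_iff_isUnit_det E).1 hE.isUnit
  obtain ⟨B, hB⟩ := CStarAlgebra.nonneg_iff_eq_star_mul_self.mp hE.posSemidef.nonneg
  rw [star_eq_conjTranspose] at hB
  have hBu : IsUnit B := by
    rw [hB, det_mul] at hEu
    exact (isUnit_iff_isUnit_det B).2 (isUnit_of_mul_isUnit_right hEu)
  refine ⟨B * M * Bᴴ, hM.mul_mul_conjTranspose_same (vecMul_injective_of_isUnit hBu), ?_, ?_, ?_⟩
  · rw [hB, Matrix.mul_assoc, trace_mul_comm, Matrix.mul_assoc]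
  · rw [hB]
    simp only [det_mul]
    ring
  · have hME : M = E⁻¹ ↔ M * E = 1 :=
      ⟨fun h => h ▸ nonsing_inv_mul E hEu, fun h => (inv_eq_left_inv h).symm⟩
    rw [hME, Matrix.mul_assoc, mul_eq_one_comm, Matrix.mul_assoc, ← hB]

end Matrix

/-- Optimal auxiliary weight matrix (Eq. (18)): for Hermitian positive definite `E`,
every Hermitian positive definite `M` satisfies
`Re(tr(M E)) - log((det M).re) ≥ n + log((det E).re)` (the determinants being
positive reals), with equality iff `M = E⁻¹`; hence `M = E⁻¹` is the unique
minimizer of `M ↦ tr(M E) - log det M` over Hermitian positive definite matrices. -/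
theorem stmt_11 (n : ℕ) (hn : 0 < n) (E : Matrix (Fin n) (Fin n) ℂ)
    (hE : E.PosDef) :
    ∀ M : Matrix (Fin n) (Fin n) ℂ, M.PosDef →
      ((n : ℝ) + Real.log E.det.re ≤ ((M * E).trace).re - Real.log M.det.re) ∧
      (((M * E).trace).re - Real.log M.det.re = (n : ℝ) + Real.log E.det.re ↔
        M = E⁻¹) := by
  intro M hM
  obtain ⟨A, hA, htr, hdet, hiff⟩ := hM.exists_posDef_trace_det_mul hE
  have hlog : Real.log A.det.re = Real.log M.det.re + Real.log E.det.re := by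
    obtain ⟨hMre, hMim⟩ := Complex.pos_iff.1 hM.det_pos
    obtain ⟨hEre, -⟩ := Complex.pos_iff.1 hE.det_pos
    rw [hdet, Complex.mul_re, ← hMim, zero_mul, sub_zero, Real.log_mul hMre.ne' hEre.ne']
  have hle := hA.log_re_det_le
  have heq := hA.log_re_det_eq_iff
  rw [hlog, htr, Fintype.card_fin] at hle heq
  refine ⟨by linarith, ?_⟩
  rw [← hiff, ← heq]
  constructor <;> intro h <;> linarith
end

section
/- Let M, U be positive integers with U ≤ M, γ > 0 real, V ∈ ℂ^{M×U}, and Σ ∈ ℂ^{M×M} Hermitian positive definite. Then: (i) for every W ∈ ℂ^{M×U} such that W^H Σ W is invertible, det(I_U + γ·W^H V V^H W·(W^H Σ W)⁻¹) ≤ det(I_U + γ·V^H Σ⁻¹ V), where both determinants are positive reals; and (ii) if V^H Σ⁻¹ V is invertible, then equality holds for W = Σ⁻¹ V. -/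
open scoped Matrix ComplexOrder

namespace Matrix

/-- A positive semidefinite perturbation of the identity has determinant at least one. -/
theorem PosSemidef.one_le_det_one_add {n : Type*} [Fintype n] [DecidableEq n]
    {P : Matrix n n ℂ} (hP : P.PosSemidef) : 1 ≤ (1 + P).det := by
  have hdet : (1 + P).det = ∏ i, (1 + (hP.isHermitian.eigenvalues i : ℂ)) := by
    have h := congrArg (Polynomial.eval (-1)) hP.isHermitian.charpoly_eq
    rw [eval_charpoly, Polynomial.eval_prod] at h
    have hscalar : (scalar n (-1 : ℂ)) - P = -(1 + P) := by
      simp only [map_neg, map_one]; abel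
    rw [hscalar, det_neg] at h
    have heval : ∀ i, Polynomial.eval (-1 : ℂ)
        (Polynomial.X - Polynomial.C (hP.isHermitian.eigenvalues i : ℂ)) =
          (-1) * (1 + (hP.isHermitian.eigenvalues i : ℂ)) := fun i => by simp; ring
    simp only [RCLike.ofReal_eq_complex_ofReal, heval, Finset.prod_mul_distrib,
      Finset.prod_const, Finset.card_univ] at h
    exact mul_left_cancel₀ (pow_ne_zero _ (by norm_num)) h
  rw [hdet]
  have h : (1 : ℝ) ≤ ∏ i, (1 + hP.isHermitian.eigenvalues i) :=
    Finset.one_le_prod fun i _ => by linarith [hP.eigenvalues_nonneg i]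
  exact_mod_cast h

open scoped MatrixOrder in
/-- The determinant is monotone on positive definite matrices in the Loewner order. -/
theorem PosDef.det_le_det_of_posSemidef_sub {n : Type*} [Fintype n] [DecidableEq n]
    {A B : Matrix n n ℂ} (hA : A.PosDef) (h : (B - A).PosSemidef) : A.det ≤ B.det := by
  obtain ⟨Y, hY⟩ := CStarAlgebra.nonneg_iff_eq_star_mul_self.mp h.nonneg
  rw [star_eq_conjTranspose] at hY
  have hB : B = A * (1 + A⁻¹ * Yᴴ * Y) := by
    rw [Matrix.mul_add, Matrix.mul_assoc, ← hY, mul_nonsing_inv_cancel_left _ _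
      ((isUnit_iff_isUnit_det _).mp hA.isUnit), Matrix.mul_one, add_sub_cancel]
  rw [hB, det_mul, det_one_add_mul_comm, ← Matrix.mul_assoc]
  exact le_mul_of_one_le_right hA.det_pos.le
    (hA.inv.posSemidef.mul_mul_conjTranspose_same Y).one_le_det_one_add

/-- The `S`-orthogonal compression of `S⁻¹` to the range of `W` is dominated by `S⁻¹`. -/
theorem PosDef.posSemidef_inv_sub_compression {m n : Type*} [Fintype m] [DecidableEq m]
    [Fintype n] [DecidableEq n] {S : Matrix m m ℂ} (hS : S.PosDef) (W : Matrix m n ℂ)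
    (hW : IsUnit (Wᴴ * S * W)) : (S⁻¹ - W * (Wᴴ * S * W)⁻¹ * Wᴴ).PosSemidef := by
  have hSdet := (isUnit_iff_isUnit_det _).mp hS.isUnit
  have hWdet := (isUnit_iff_isUnit_det _).mp hW
  have hK : (W * (Wᴴ * S * W)⁻¹ * Wᴴ).IsHermitian :=
    isHermitian_mul_mul_conjTranspose W (isHermitian_conjTranspose_mul_mul W hS.isHermitian).inv
  have hKSK : W * (Wᴴ * S * W)⁻¹ * Wᴴ * S * (W * (Wᴴ * S * W)⁻¹ * Wᴴ) =
      W * (Wᴴ * S * W)⁻¹ * Wᴴ := by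
    calc _ = W * ((Wᴴ * S * W)⁻¹ * (Wᴴ * S * W)) * (Wᴴ * S * W)⁻¹ * Wᴴ := by
          simp only [Matrix.mul_assoc]
      _ = _ := by rw [nonsing_inv_mul _ hWdet, Matrix.mul_one]
  have h := hS.posSemidef.conjTranspose_mul_mul_same (S⁻¹ - W * (Wᴴ * S * W)⁻¹ * Wᴴ)
  rw [(hS.isHermitian.inv.sub hK).eq] at h
  convert h using 1
  rw [Matrix.sub_mul, nonsing_inv_mul _ hSdet, Matrix.sub_mul, Matrix.one_mul,
    Matrix.mul_sub, hKSK, mul_nonsing_inv_cancel_right _ _ hSdet, sub_self, sub_zero]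

end Matrix

/-- Determinant inequality underlying the rate/WMMSE equivalence: for `γ > 0`,
`V ∈ ℂ^{M×U}` (`U ≤ M`) and Hermitian positive definite `Σ`,
(i) every combiner `W` with `Wᴴ Σ W` invertible satisfies
`det(I + γ Wᴴ V Vᴴ W (Wᴴ Σ W)⁻¹) ≤ det(I + γ Vᴴ Σ⁻¹ V)` (both determinants being
positive reals, compared via their real parts), and
(ii) if `Vᴴ Σ⁻¹ V` is invertible, equality holds for the whitened matched filter
`W = Σ⁻¹ V`. -/
theorem stmt_14 (M U : ℕ) (hM : 0 < M) (hU : 0 < U) (hUM : U ≤ M)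
    (γ : ℝ) (hγ : 0 < γ)
    (V : Matrix (Fin M) (Fin U) ℂ)
    (Sig : Matrix (Fin M) (Fin M) ℂ) (hSig : Sig.PosDef) :
    (∀ W : Matrix (Fin M) (Fin U) ℂ, IsUnit (Wᴴ * Sig * W) →
      (((1 : Matrix (Fin U) (Fin U) ℂ)
          + (γ : ℂ) • (Wᴴ * V * Vᴴ * W * (Wᴴ * Sig * W)⁻¹)).det).re ≤
        (((1 : Matrix (Fin U) (Fin U) ℂ) + (γ : ℂ) • (Vᴴ * Sig⁻¹ * V)).det).re) ∧
    (IsUnit (Vᴴ * Sig⁻¹ * V) →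
      (((1 : Matrix (Fin U) (Fin U) ℂ)
          + (γ : ℂ) • ((Sig⁻¹ * V)ᴴ * V * Vᴴ * (Sig⁻¹ * V)
              * ((Sig⁻¹ * V)ᴴ * Sig * (Sig⁻¹ * V))⁻¹)).det).re =
        (((1 : Matrix (Fin U) (Fin U) ℂ) + (γ : ℂ) • (Vᴴ * Sig⁻¹ * V)).det).re) := by
  have hSdet := (Matrix.isUnit_iff_isUnit_det _).mp hSig.isUnit
  have hγ' : (0 : ℂ) ≤ (γ : ℂ) := by exact_mod_cast hγ.le
  refine ⟨fun W hW => ?_, fun hG => ?_⟩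
  · have hA : (1 + (γ : ℂ) • (Vᴴ * (W * (Wᴴ * Sig * W)⁻¹ * Wᴴ) * V)).PosDef :=
      Matrix.PosDef.one.add_posSemidef
        ((((hSig.posSemidef.conjTranspose_mul_mul_same W).inv.mul_mul_conjTranspose_same
          W).conjTranspose_mul_mul_same V).smul hγ')
    have hdet : (1 + (γ : ℂ) • (Wᴴ * V * Vᴴ * W * (Wᴴ * Sig * W)⁻¹)).det =
        (1 + (γ : ℂ) • (Vᴴ * (W * (Wᴴ * Sig * W)⁻¹ * Wᴴ) * V)).det := by
      have h := Matrix.det_one_add_mul_comm (Wᴴ * V)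
        ((γ : ℂ) • (Vᴴ * W * (Wᴴ * Sig * W)⁻¹))
      simpa only [Matrix.mul_smul, Matrix.smul_mul, Matrix.mul_assoc] using h
    rw [hdet]
    refine (Complex.le_def.mp (hA.det_le_det_of_posSemidef_sub ?_)).1
    rw [add_sub_add_left_eq_sub, ← smul_sub, ← Matrix.sub_mul, ← Matrix.mul_sub]
    exact ((hSig.posSemidef_inv_sub_compression W hW).conjTranspose_mul_mul_same V).smul hγ'
  · have hGdet := (Matrix.isUnit_iff_isUnit_det _).mp hG
    have hconj : (Sig⁻¹ * V)ᴴ = Vᴴ * Sig⁻¹ := by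
      rw [Matrix.conjTranspose_mul, hSig.isHermitian.inv.eq]
    have hnoise : Vᴴ * Sig⁻¹ * Sig * (Sig⁻¹ * V) = Vᴴ * Sig⁻¹ * V := by
      rw [Matrix.nonsing_inv_mul_cancel_right _ _ hSdet, Matrix.mul_assoc]
    have hsignal : Vᴴ * Sig⁻¹ * V * Vᴴ * (Sig⁻¹ * V) =
        (Vᴴ * Sig⁻¹ * V) * (Vᴴ * Sig⁻¹ * V) := by
      simp only [Matrix.mul_assoc]
    rw [hconj, hnoise, hsignal, Matrix.mul_nonsing_inv_cancel_right _ _ hGdet]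
end
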